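/- If Γ is a finite tree with at least one essential vertex (vertex of degree ≥ 3) and n ≥ 2, then the symmetric group orbit space structure gives: for any two points ã, ã′ in the fiber π^{-1}(a) ⊂ D^n(Γ) over a point a ∈ UD^n(Γ), there exists a path in D^n(Γ) from ã to ã′; i.e., the ordered configuration space of a tree with an essential vertex is path-connected. (Special case of Abrams' connectivity theorem: C^n(Γ) is path-connected when Γ is connected, n ≥ 2, and Γ is not homeomorphic to an interval or circle — for trees, having an essential vertex suffices.) -/

import Mathlib

/-- The ordered topological configuration space `C^n(X)` of `n` distinct points in `X`. -/
def OrderedConfig (n : ℕ) (X : Type*) [TopologicalSpace X] : Type _ :=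
  {f : Fin n → X // Function.Injective f}

instance OrderedConfig.topologicalSpace (n : ℕ) (X : Type*) [TopologicalSpace X] :
    TopologicalSpace (OrderedConfig n X) :=
  instTopologicalSpaceSubtype

/-- The symmetric group `S_n` acts on `C^n(X)` by permuting coordinates. -/
instance OrderedConfig.mulAction (n : ℕ) (X : Type*) [TopologicalSpace X] :
    MulAction (Equiv.Perm (Fin n)) (OrderedConfig n X) where
  smul α f := ⟨f.1 ∘ α.symm, f.2.comp α.symm.injective⟩
  one_smul f := Subtype.ext rfl
  mul_smul α β f := Subtype.ext rfl

/-- The unordered topological configuration space `UC^n(X) = C^n(X)/S_n`. -/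
def UnorderedConfig (n : ℕ) (X : Type*) [TopologicalSpace X] : Type _ :=
  Quotient (MulAction.orbitRel (Equiv.Perm (Fin n)) (OrderedConfig n X))

instance UnorderedConfig.topologicalSpace (n : ℕ) (X : Type*) [TopologicalSpace X] :
    TopologicalSpace (UnorderedConfig n X) :=
  instTopologicalSpaceQuotient

/-- A finite graph (finite 1-dimensional CW complex), given by finite sets of vertices and
edges together with an endpoints map. -/
structure FinGraph where
  V : Type
  E : Type
  [fintV : Fintype V]
  [fintE : Fintype E]
  ends : E → V × V

namespace FinGraph

instance (G : FinGraph) : TopologicalSpace G.V := ⊥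
instance (G : FinGraph) : TopologicalSpace G.E := ⊥

/-- The gluing relation identifying the endpoints of each edge-interval with the corresponding
vertices. -/
inductive GlueRel (G : FinGraph) :
    ((G.E × unitInterval) ⊕ G.V) → ((G.E × unitInterval) ⊕ G.V) → Prop
  | src (e : G.E) : GlueRel G (Sum.inl (e, 0)) (Sum.inr (G.ends e).1)
  | tgt (e : G.E) : GlueRel G (Sum.inl (e, 1)) (Sum.inr (G.ends e).2)

/-- The geometric realization of a finite graph as a topological space. -/
def Realization (G : FinGraph) : Type :=
  Quot G.GlueRel

instance (G : FinGraph) : TopologicalSpace G.Realization :=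
  instTopologicalSpaceQuot

end FinGraph

/-- The geometric realization of a finite simple graph, with edges oriented by a linear order. -/
def SimpleGraph.toFinGraph (V : Type) [Fintype V] [LinearOrder V] (G : SimpleGraph V)
    [DecidableRel G.Adj] : FinGraph where
  V := V
  E := {p : V × V // G.Adj p.1 p.2 ∧ p.1 < p.2}
  ends := fun e => e.1


namespace TreeConf

def Conf {X : Type} (ι : Type) (A : Set X) : Set (ι → X) :=
  {f | Function.Injective f ∧ ∀ i, f i ∈ A}

def PC {X : Type} [TopologicalSpace X] (A : Set X) : Prop :=
  ∀ (ι : Type) [Finite ι] (f g : ι → X), f ∈ Conf ι A → g ∈ Conf ι A → JoinedIn (Conf ι A) f g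

variable {X : Type} [TopologicalSpace X]

theorem Conf_mono {ι : Type} {A B : Set X} (h : A ⊆ B) : Conf ι A ⊆ Conf ι B :=
  fun _ hf => ⟨hf.1, fun i => h (hf.2 i)⟩

open Classical in
/-- replace the values on `s` -/
noncomputable def glue {ι : Type} (s : Set ι) (f : ι → X) (g : s → X) : ι → X :=
  fun x => if h : x ∈ s then g ⟨x, h⟩ else f x

theorem glue_mem {ι : Type} {s : Set ι} {f : ι → X} {g : s → X} {x : ι} (h : x ∈ s) :
    glue s f g x = g ⟨x, h⟩ := by simp [glue, h]

theorem glue_not {ι : Type} {s : Set ι} {f : ι → X} {g : s → X} {x : ι} (h : x ∉ s) :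
    glue s f g x = f x := by simp [glue, h]

theorem glue_conf {ι : Type} {A B : Set X} (hAB : A ⊆ B) {f : ι → X}
    (hf : f ∈ Conf ι B) {s : Set ι} (hs' : ∀ x ∉ s, f x ∉ A)
    {g : s → X} (hg : g ∈ Conf s A) : glue s f g ∈ Conf ι B := by
  constructor
  · intro x y hxy
    by_cases hx : x ∈ s <;> by_cases hy : y ∈ s
    · rw [glue_mem hx, glue_mem hy] at hxy
      simpa using hg.1 hxy
    · rw [glue_mem hx, glue_not hy] at hxy
      exact absurd (hxy ▸ hg.2 _) (hs' y hy)
    · rw [glue_not hx, glue_mem hy] at hxy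
      exact absurd (hxy ▸ hg.2 _) (hs' x hx)
    · rw [glue_not hx, glue_not hy] at hxy
      exact hf.1 hxy
  · intro x
    by_cases hx : x ∈ s
    · rw [glue_mem hx]; exact hAB (hg.2 _)
    · rw [glue_not hx]; exact hf.2 _

theorem joined_glue {ι : Type} {A B : Set X} (hAB : A ⊆ B) {f : ι → X}
    (hf : f ∈ Conf ι B) {s : Set ι} (hs : ∀ x ∈ s, f x ∈ A) (hs' : ∀ x ∉ s, f x ∉ A)
    (hP : ∀ f g : s → X, f ∈ Conf s A → g ∈ Conf s A → JoinedIn (Conf s A) f g)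
    {g : s → X} (hg : g ∈ Conf s A) : JoinedIn (Conf ι B) f (glue s f g) := by
  have h0 : (fun x : s => f x) ∈ Conf s A :=
    ⟨fun x y h => Subtype.ext (hf.1 h), fun x => hs _ x.2⟩
  obtain ⟨γ, hγ⟩ := hP _ g h0 hg
  refine ⟨⟨⟨fun t => glue s f (γ t), ?_⟩, ?_, ?_⟩, fun t => glue_conf hAB hf hs' (hγ t)⟩
  · refine continuous_pi fun x => ?_
    by_cases hx : x ∈ s
    · simp only [glue_mem hx]
      exact (continuous_apply _).comp γ.continuous
    · simp only [glue_not hx]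
      exact continuous_const
  · funext x
    by_cases hx : x ∈ s
    · simp [glue_mem hx]
    · simp [glue_not hx]
  · simp

/-- attach an arc -/
theorem attach {A : Set X} (hA : PC A) (hinf : A.Infinite) {c : ℝ → X} (hc : Continuous c)
    (h0 : c 0 ∈ A) (hinj : Set.InjOn c (Set.Icc 0 1)) (hd : ∀ t ∈ Set.Ioo (0:ℝ) 1, c t ∉ A) :
    PC (A ∪ c '' Set.Icc 0 1) := by
  intro ι _
  have key : ∀ (k : ℕ) (f : ι → X), f ∈ Conf ι (A ∪ c '' Set.Icc 0 1) →
      {x | f x ∉ A}.ncard = k →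
      ∃ g ∈ Conf ι A, JoinedIn (Conf ι (A ∪ c '' Set.Icc 0 1)) f g := by
    intro k
    induction k with
    | zero =>
      intro f hf hk
      rw [Set.ncard_eq_zero (Set.toFinite _)] at hk
      refine ⟨f, ⟨hf.1, fun i => ?_⟩, JoinedIn.refl hf⟩
      by_contra h
      have : i ∈ {x | f x ∉ A} := h
      rw [hk] at this
      exact this
    | succ k ih =>
      intro f hf hk
      have hpar : ∀ x, ∃ t, f x ∉ A → t ∈ Set.Icc (0:ℝ) 1 ∧ c t = f x := by
        intro x
        by_cases h : f x ∈ A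
        · exact ⟨0, fun h' => absurd h h'⟩
        · rcases hf.2 x with h' | ⟨t, ht, h'⟩
          · exact absurd h' h
          · exact ⟨t, fun _ => ⟨ht, h'⟩⟩
      choose τ hτ using hpar
      have hne : {x | f x ∉ A}.Nonempty := by
        apply Set.nonempty_of_ncard_ne_zero; omega
      obtain ⟨m, hm, hmin⟩ := Set.exists_min_image _ τ (Set.toFinite _) hne
      have hinf' : (A \ {c 0}).Infinite := hinf.sdiff (Set.finite_singleton _)
      haveI := hinf'.to_subtype
      haveI : Finite {x | f x ∈ A} := inferInstance
      obtain ⟨N, ⟨eN⟩⟩ := Finite.exists_equiv_fin {x | f x ∈ A}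
      let emb := Infinite.natEmbedding (A \ {c 0} : Set X)
      let g : {x | f x ∈ A} → X := fun x => (emb (eN x : ℕ)).1
      have hgA : ∀ x, g x ∈ A \ {c 0} := fun x => (emb (eN x : ℕ)).2
      have hg : g ∈ Conf {x | f x ∈ A} A := by
        refine ⟨fun x y h => ?_, fun x => (hgA x).1⟩
        have := emb.injective (Subtype.ext h)
        exact eN.injective (Fin.ext this)
      have J1 := joined_glue (A := A) (B := A ∪ c '' Set.Icc 0 1) Set.subset_union_left hf
        (s := {x | f x ∈ A}) (fun x h => h) (fun x h => h) (hA _) hg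
      set f' := glue {x | f x ∈ A} f g with hf'
      have hf'c : f' ∈ Conf ι (A ∪ c '' Set.Icc 0 1) := J1.target_mem
      have hmm : m ∉ {x | f x ∈ A} := hm
      have hτm := hτ m hm
      classical
      have hconf : ∀ s ∈ Set.Icc 0 (τ m),
          Function.update f' m (c s) ∈ Conf ι (A ∪ c '' Set.Icc 0 1) := by
        intro s hs
        have hs1 : s ∈ Set.Icc (0:ℝ) 1 := ⟨hs.1, hs.2.trans hτm.1.2⟩
        have hav : ∀ x, x ≠ m → f' x ≠ c s := by
          intro x hx he
          by_cases hxA : x ∈ {x | f x ∈ A}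
          · rw [hf', glue_mem hxA] at he
            have h1 := hgA ⟨x, hxA⟩
            rw [he] at h1
            rcases eq_or_lt_of_le hs.1 with h2 | h2
            · exact h1.2 (by rw [← h2]; rfl)
            · rcases eq_or_lt_of_le hs.2 with h3 | h3
              · rw [h3, hτm.2] at h1; exact hm h1.1
              · exact hd s ⟨h2, h3.trans_le hτm.1.2⟩ h1.1
          · rw [hf', glue_not hxA] at he
            have h1 := hτ x hxA
            have h2 := hmin x hxA
            rw [← h1.2] at he
            have h3 := hinj h1.1 hs1 he
            have h4 : τ x = τ m := le_antisymm (h3 ▸ hs.2) h2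
            exact hx (hf.1 (by rw [← h1.2, ← hτm.2, h4]))
        constructor
        · intro x y hxy
          by_cases hx : x = m <;> by_cases hy : y = m
          · rw [hx, hy]
          · subst hx
            rw [Function.update_self, Function.update_of_ne hy] at hxy
            exact absurd hxy.symm (hav y hy)
          · subst hy
            rw [Function.update_self, Function.update_of_ne hx] at hxy
            exact absurd hxy (hav x hx)
          · rw [Function.update_of_ne hy, Function.update_of_ne hx] at hxy
            exact hf'c.1 hxy
        · intro x
          by_cases hx : x = m
          · subst hx
            rw [Function.update_self]
            exact Or.inr ⟨s, hs1, rfl⟩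
          · rw [Function.update_of_ne hx]; exact hf'c.2 x
      have J2 : JoinedIn (Conf ι (A ∪ c '' Set.Icc 0 1)) f' (Function.update f' m (c 0)) := by
        refine JoinedIn.ofLine (f := fun t : ℝ => Function.update f' m (c ((1 - t) * τ m)))
          ?_ ?_ ?_ ?_
        · apply Continuous.continuousOn
          exact continuous_const.update m (hc.comp (by fun_prop))
        · have : f' m = c (τ m) := by rw [hf', glue_not hmm, hτm.2]
          simp [← this]
        · simp
        · rintro _ ⟨t, ht, rfl⟩
          have := hτm.1.1
          exact hconf _ ⟨mul_nonneg (by linarith [ht.2]) this, by nlinarith [ht.1]⟩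
      obtain ⟨g', hg', J3⟩ := ih _ J2.target_mem (by
        have : {x | f x ∉ A} = insert m {x | Function.update f' m (c 0) x ∉ A} := by
          ext x
          by_cases hx : x = m
          · subst hx; simpa using hm
          · simp only [Set.mem_ofPred_eq, Set.mem_insert_iff, hx, false_or,
              Function.update_of_ne hx]
            by_cases hxA : x ∈ {x | f x ∈ A}
            · rw [hf', glue_mem hxA]
              have : f x ∈ A := hxA
              simp [this, (hgA ⟨x, hxA⟩).1]
            · rw [hf', glue_not hxA]
        rw [this, Set.ncard_insert_of_notMem (by simpa using h0) (Set.toFinite _)] at hk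
        omega)
      exact ⟨g', hg', (J1.trans J2).trans J3⟩
  intro f g hf hg
  obtain ⟨f', hf', J⟩ := key _ f hf rfl
  obtain ⟨g', hg', J'⟩ := key _ g hg rfl
  exact (J.trans ((hA ι f' g' hf' hg').mono (Conf_mono Set.subset_union_left))).trans J'.symm


def Star (γ : Fin 3 → ℝ → X) (r : ℝ) : Set X := {x | ∃ i, ∃ s ∈ Set.Icc 0 r, x = γ i s}

structure IsStar (γ : Fin 3 → ℝ → X) : Prop where
  cont : ∀ i, Continuous (γ i)
  zero : ∀ i j, γ i 0 = γ j 0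
  inj : ∀ i j, ∀ s ∈ Set.Icc (0:ℝ) 1, ∀ t ∈ Set.Icc (0:ℝ) 1, γ i s = γ j t →
    s = t ∧ (i = j ∨ s = 0)

theorem star_conf {γ : Fin 3 → ℝ → X} (hγ : IsStar γ) {r : ℝ} (hr : r ≤ 1) {ι : Type}
    (I : ι → Fin 3) (S : ι → ℝ) (hS : ∀ x, 0 ≤ S x ∧ S x ≤ r)
    (hne : ∀ x y, x ≠ y → S x = S y → I x ≠ I y ∧ 0 < S x) :
    (fun x => γ (I x) (S x)) ∈ Conf ι (Star γ r) := by
  refine ⟨fun x y hxy => ?_, fun x => ⟨I x, S x, ⟨(hS x).1, (hS x).2⟩, rfl⟩⟩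
  by_contra h
  obtain ⟨h1, h2⟩ := hγ.inj _ _ _ ⟨(hS x).1, (hS x).2.trans hr⟩ _ ⟨(hS y).1, (hS y).2.trans hr⟩ hxy
  obtain ⟨h3, h4⟩ := hne x y h h1
  rcases h2 with h2 | h2
  · exact h3 h2
  · exact h4.ne' h2

theorem star_joined {γ : Fin 3 → ℝ → X} (hγ : IsStar γ) {r : ℝ} (hr : r ≤ 1) {ι : Type}
    (I : ι → Fin 3) (S T : ι → ℝ) (hS : ∀ x, 0 ≤ S x ∧ S x ≤ r) (hT : ∀ x, 0 ≤ T x ∧ T x ≤ r)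
    (hne : ∀ t ∈ Set.Icc (0:ℝ) 1, ∀ x y, x ≠ y →
      (1 - t) * S x + t * T x = (1 - t) * S y + t * T y →
        I x ≠ I y ∧ 0 < (1 - t) * S x + t * T x) :
    JoinedIn (Conf ι (Star γ r)) (fun x => γ (I x) (S x)) (fun x => γ (I x) (T x)) := by
  refine JoinedIn.ofLine (f := fun t : ℝ => fun x => γ (I x) ((1 - t) * S x + t * T x)) ?_ ?_ ?_ ?_
  · apply Continuous.continuousOn
    exact continuous_pi fun x => (hγ.cont _).comp (by fun_prop)
  · simp
  · simp
  · rintro _ ⟨t, ht, rfl⟩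
    refine star_conf hγ hr I _ (fun x => ⟨?_, ?_⟩) (hne t ht)
    · have := ht.1; have := ht.2; have := (hS x).1; have := (hT x).1
      have := mul_nonneg (sub_nonneg.2 ht.2) (hS x).1
      positivity
    · have := ht.1; have := ht.2; have := (hS x).2; have := (hT x).2
      nlinarith [mul_nonneg (sub_nonneg.2 ht.2) (sub_nonneg.2 (hS x).2),
        mul_nonneg ht.1 (sub_nonneg.2 (hT x).2)]

/-- `m` at the tip of leg `i`, the others in the half star. -/
def Tip (γ : Fin 3 → ℝ → X) (r : ℝ) {ι : Type} (i : Fin 3) (m : ι) : Set (ι → X) :=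
  {f | f ∈ Conf ι (Star γ r) ∧ f m = γ i r ∧ ∀ x, x ≠ m → f x ∈ Star γ (r / 2)}

theorem exists_pos_fun {ι : Type} [Finite ι] {r : ℝ} (hr : 0 < r) :
    ∃ p : ι → ℝ, Function.Injective p ∧ ∀ x, 0 < p x ∧ p x ≤ r / 2 := by
  obtain ⟨N, ⟨e⟩⟩ := Finite.exists_equiv_fin ι
  refine ⟨fun x => r / ((e x : ℕ) + 2), fun x y h => ?_, fun x => ⟨by positivity, ?_⟩⟩
  · simp only at h
    have h1 : (0:ℝ) < (e x : ℕ) + 2 := by positivity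
    have h2 : (0:ℝ) < (e y : ℕ) + 2 := by positivity
    rw [div_eq_div_iff h1.ne' h2.ne'] at h
    have h3 := mul_left_cancel₀ hr.ne' h
    have h4 : ((e x : ℕ) : ℝ) = (e y : ℕ) := by linarith
    exact e.injective (Fin.ext (by exact_mod_cast h4))
  · apply div_le_div_of_nonneg_left hr.le (by norm_num)
    have : (0:ℝ) ≤ (e x : ℕ) := by positivity
    linarith

theorem to_tip {γ : Fin 3 → ℝ → X} (hγ : IsStar γ) {r : ℝ} (hr0 : 0 < r) (hr : r ≤ 1) {ι : Type}
    [Finite ι] [Nonempty ι] {f : ι → X} (hf : f ∈ Conf ι (Star γ r)) :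
    ∃ i m, ∃ g ∈ Tip γ r i m, JoinedIn (Conf ι (Star γ r)) f g := by
  classical
  choose I S hS hfS using hf.2
  obtain ⟨m, hm⟩ := Finite.exists_max S
  have hfe : f = fun x => γ (I x) (S x) := funext hfS
  have hne : ∀ x y, x ≠ y → S x = S y → I x ≠ I y ∧ 0 < S x := by
    intro x y hxy h
    refine ⟨fun h' => hxy (hf.1 (by rw [hfS, hfS, h, h'])), ?_⟩
    rcases eq_or_lt_of_le (hS x).1 with h0 | h0
    · exact absurd (hf.1 (by rw [hfS, hfS, ← h, ← h0]; exact hγ.zero _ _)) hxy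
    · exact h0
  have J1 : JoinedIn (Conf ι (Star γ r)) (fun x => γ (I x) (S x)) (fun x => γ (I x) (S x / 2)) := by
    refine star_joined hγ hr I _ _ hS (fun x => ⟨by linarith [(hS x).1], by linarith [(hS x).1, (hS x).2]⟩) ?_
    intro t ht x y hxy h
    have h1 : (1 - t / 2) * S x = (1 - t / 2) * S y := by linarith
    have h2 : 0 < 1 - t / 2 := by linarith [ht.2]
    have h3 := mul_left_cancel₀ h2.ne' h1
    obtain ⟨h4, h5⟩ := hne x y hxy h3
    refine ⟨h4, ?_⟩
    have := mul_pos h2 h5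
    linarith
  have J2 : JoinedIn (Conf ι (Star γ r)) (fun x => γ (I x) (S x / 2))
      (fun x => γ (I x) (if x = m then r else S x / 2)) := by
    have hb : ∀ x, 0 ≤ S x / 2 ∧ S x / 2 ≤ r := 
      fun x => ⟨by linarith [(hS x).1], by linarith [(hS x).1, (hS x).2]⟩
    have hmr : S m / 2 < r := by linarith [(hS m).2]
    refine star_joined hγ hr I _ _ hb (fun x => ?_) ?_
    · split_ifs
      · exact ⟨hr0.le, le_rfl⟩
      · exact hb x
    have aux : ∀ t ∈ Set.Icc (0:ℝ) 1, ∀ y, y ≠ m →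
        (1 - t) * (S m / 2) + t * r = S y / 2 → I m ≠ I y ∧ 0 < S y / 2 := by
      intro t ht y hy h
      have h1 := hm y
      have h2 : 0 ≤ t * (r - S m / 2) := mul_nonneg ht.1 (by linarith)
      have h3 : S y = S m := by linarith
      have := hne m y hy.symm h3.symm
      exact ⟨this.1, by linarith [this.2]⟩
    intro t ht x y hxy h
    by_cases hx : x = m <;> by_cases hy : y = m
    · exact absurd (hx.trans hy.symm) hxy
    · subst hx
      simp only [if_true, if_neg hy] at h ⊢
      have h1 : (1 - t) * (S x / 2) + t * r = S y / 2 := by linarith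
      have := aux t ht y hy h1
      exact ⟨this.1, by rw [h1]; exact this.2⟩
    · subst hy
      simp only [if_true, if_neg hx] at h ⊢
      have h1 : (1 - t) * (S y / 2) + t * r = S x / 2 := by linarith
      have := aux t ht x hx h1
      exact ⟨this.1.symm, by linarith [this.2]⟩
    · simp only [if_neg hx, if_neg hy] at h ⊢
      have := hne x y hxy (by linarith)
      exact ⟨this.1, by linarith [this.2]⟩
  refine ⟨I m, m, _, ⟨J2.target_mem, by simp, fun x hx => ?_⟩, hfe ▸ J1.trans J2⟩
  simp only [if_neg hx]
  exact ⟨I x, S x / 2, ⟨by linarith [(hS x).1], by linarith [(hS x).2]⟩, rfl⟩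

theorem star_mono {γ : Fin 3 → ℝ → X} {r s : ℝ} (h : r ≤ s) : Star γ r ⊆ Star γ s := by
  rintro _ ⟨i, t, ht, rfl⟩
  exact ⟨i, t, ⟨ht.1, ht.2.trans h⟩, rfl⟩

theorem tip_joined {γ : Fin 3 → ℝ → X} (hγ : IsStar γ) {r : ℝ} (hr0 : 0 < r) (hr : r ≤ 1) {ι : Type}
    {i : Fin 3} {m : ι}
    (hP : ∀ f g : ({m}ᶜ : Set ι) → X, f ∈ Conf _ (Star γ (r/2)) → g ∈ Conf _ (Star γ (r/2)) →
      JoinedIn (Conf _ (Star γ (r/2))) f g)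
    {f g : ι → X} (hf : f ∈ Tip γ r i m) (hg : g ∈ Tip γ r i m) :
    JoinedIn (Conf ι (Star γ r)) f g := by
  have hs : ∀ x ∉ ({m}ᶜ : Set ι), f x ∉ Star γ (r/2) := by
    intro x hx
    have hx : x = m := by simpa using hx
    rw [hx, hf.2.1]
    rintro ⟨j, s, hs, h⟩
    have := (hγ.inj _ _ _ ⟨hr0.le, hr⟩ _ ⟨hs.1, by linarith [hs.2]⟩ h).1
    linarith [hs.2]
  have J := joined_glue (A := Star γ (r/2)) (B := Star γ r) (star_mono (by linarith)) hf.1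
    (s := ({m}ᶜ : Set ι)) (fun x hx => hf.2.2 x hx) hs hP (g := fun x => g x)
    ⟨fun x y h => Subtype.ext (hg.1.1 h), fun x => hg.2.2 x x.2⟩
  convert J using 1
  funext x
  by_cases hx : x = m
  · rw [glue_not (by simpa using hx), hx, hf.2.1, hg.2.1]
  · rw [glue_mem (by simpa using hx)]

theorem tip_move {γ : Fin 3 → ℝ → X} (hγ : IsStar γ) {r : ℝ} (hr0 : 0 < r) (hr : r ≤ 1) {ι : Type}
    [Finite ι] {i j : Fin 3} (hij : i ≠ j) (m : ι) :
    ∃ f ∈ Tip γ r i m, ∃ g ∈ Tip γ r j m, JoinedIn (Conf ι (Star γ r)) f g := by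
  classical
  obtain ⟨p, hp, hp'⟩ := exists_pos_fun (ι := ι) hr0
  obtain ⟨k, hki, hkj⟩ : ∃ k : Fin 3, k ≠ i ∧ k ≠ j := by
    revert i j; decide
  have J : ∀ l, k ≠ l → JoinedIn (Conf ι (Star γ r))
      (fun x => γ (if x = m then l else k) (if x = m then r else p x))
      (fun x => γ (if x = m then l else k) (if x = m then 0 else p x)) := by
    intro l hl
    refine star_joined hγ hr _ _ _ (fun x => ?_) (fun x => ?_) ?_
    · have := hp' x
      split_ifs <;> constructor <;> linarith
    · have := hp' x
      split_ifs <;> constructor <;> linarith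
    · intro t ht x y hxy h
      have := hp' x
      have := hp' y
      have h3 : p x ≠ p y := fun h => hxy (hp h)
      by_cases hx : x = m <;> by_cases hy : y = m
      · exact absurd (hx.trans hy.symm) hxy
      · simp only [if_pos hx, if_neg hy] at h ⊢
        exact ⟨hl.symm, by linarith⟩
      · simp only [if_neg hx, if_pos hy] at h ⊢
        exact ⟨hl, by linarith⟩
      · simp only [if_neg hx, if_neg hy] at h ⊢
        exact absurd (by linarith) h3
  have hT : ∀ l, k ≠ l → (fun x => γ (if x = m then l else k) (if x = m then r else p x)) ∈ Tip γ r l m := by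
    intro l hl
    refine ⟨(J l hl).source_mem, by simp, fun x hx => ?_⟩
    simp only [if_neg hx]
    exact ⟨k, p x, ⟨(hp' x).1.le, (hp' x).2⟩, rfl⟩
  refine ⟨_, hT i hki, _, hT j hkj, (J i hki).trans ?_⟩
  convert (J j hkj).symm using 1
  funext x
  by_cases hx : x = m
  · simp only [if_pos hx]; exact hγ.zero _ _
  · simp only [if_neg hx]

theorem tip_swap {γ : Fin 3 → ℝ → X} (hγ : IsStar γ) {r : ℝ} (hr0 : 0 < r) (hr : r ≤ 1) {ι : Type}
    [Finite ι] {i j : Fin 3} (hij : i ≠ j) {m m' : ι} (hm : m ≠ m') :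
    ∃ f ∈ Tip γ r i m, ∃ g ∈ Tip γ r j m', JoinedIn (Conf ι (Star γ r)) f g := by
  classical
  obtain ⟨p, hp, hp'⟩ := exists_pos_fun (ι := ι) hr0
  obtain ⟨k, hki, hkj⟩ : ∃ k : Fin 3, k ≠ i ∧ k ≠ j := by
    revert i j; decide
  have J : JoinedIn (Conf ι (Star γ r))
      (fun x => γ (if x = m then i else if x = m' then j else k)
        (if x = m then r else if x = m' then r / 2 else p x))
      (fun x => γ (if x = m then i else if x = m' then j else k)
        (if x = m then r / 2 else if x = m' then r else p x)) := by
    refine star_joined hγ hr _ _ _ (fun x => ?_) (fun x => ?_) ?_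
    · have := hp' x
      split_ifs <;> constructor <;> linarith
    · have := hp' x
      split_ifs <;> constructor <;> linarith
    · intro t ht x y hxy h
      have h1 := hp' x
      have := hp' y
      have h3 : p x ≠ p y := fun h => hxy (hp h)
      have h4 : 0 ≤ t * r := mul_nonneg ht.1 hr0.le
      have h5 : 0 ≤ (1 - t) * r := mul_nonneg (by linarith [ht.2]) hr0.le
      refine ⟨?_, ?_⟩
      · intro hI
        by_cases hx : x = m <;> by_cases hy : y = m <;> by_cases hx' : x = m' <;>
          by_cases hy' : y = m' <;> simp_all
        all_goals exact h3 (by linarith)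
      · split_ifs
        · linarith
        · linarith
        · linarith
  refine ⟨_, ⟨J.source_mem, by simp, fun x hx => ?_⟩, _, ⟨J.target_mem, by simp [hm.symm], fun x hx => ?_⟩, J⟩
  · refine ⟨_, _, ⟨?_, ?_⟩, rfl⟩ <;> have := hp' x <;> split_ifs <;>
      first | contradiction | linarith
  · refine ⟨_, _, ⟨?_, ?_⟩, rfl⟩ <;> have := hp' x <;> split_ifs <;>
      first | contradiction | linarith

theorem star_pc_aux {γ : Fin 3 → ℝ → X} (hγ : IsStar γ) (n : ℕ) : ∀ (ι : Type) [Finite ι],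
    Nat.card ι = n → ∀ r : ℝ, 0 < r → r ≤ 1 → 
    ∀ f g : ι → X, f ∈ Conf ι (Star γ r) → g ∈ Conf ι (Star γ r) →
      JoinedIn (Conf ι (Star γ r)) f g := by
  induction n with
  | zero =>
    intro ι _ hc r hr0 hr f g hf hg
    have : IsEmpty ι := Finite.card_eq_zero_iff.1 hc
    rw [Subsingleton.elim g f]
    exact JoinedIn.refl hf
  | succ n ih =>
    intro ι _ hc r hr0 hr f g hf hg
    have : Nonempty ι := (Finite.card_pos_iff).1 (by omega)
    have hP : ∀ m : ι, ∀ f g : ({m}ᶜ : Set ι) → X, f ∈ Conf _ (Star γ (r/2)) →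
        g ∈ Conf _ (Star γ (r/2)) → JoinedIn (Conf _ (Star γ (r/2))) f g := by
      intro m
      refine ih _ ?_ _ (by linarith) (by linarith)
      have := Set.ncard_add_ncard_compl ({m} : Set ι)
      rw [Set.ncard_singleton, hc] at this
      change Set.ncard _ = n
      omega
    have hT : ∀ (i j : Fin 3) (m m' : ι), i ≠ j → ∀ f ∈ Tip γ r i m, ∀ g ∈ Tip γ r j m',
        JoinedIn (Conf ι (Star γ r)) f g := by
      intro i j m m' hij f hf g hg
      by_cases hm : m = m'
      · subst hm
        obtain ⟨f', hf', g', hg', J⟩ := tip_move hγ hr0 hr hij m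
        exact ((tip_joined hγ hr0 hr (hP _) hf hf').trans J).trans
          (tip_joined hγ hr0 hr (hP _) hg' hg)
      · obtain ⟨f', hf', g', hg', J⟩ := tip_swap hγ hr0 hr hij hm
        exact ((tip_joined hγ hr0 hr (hP _) hf hf').trans J).trans
          (tip_joined hγ hr0 hr (hP _) hg' hg)
    obtain ⟨i, m, f', hf', J⟩ := to_tip hγ hr0 hr hf
    obtain ⟨j, m', g', hg', J'⟩ := to_tip hγ hr0 hr hg
    obtain ⟨k, hki, hkj⟩ : ∃ k : Fin 3, k ≠ i ∧ k ≠ j := by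
      clear * -; revert i j; decide
    obtain ⟨l, hl⟩ : ∃ l : Fin 3, l ≠ k := ⟨i, hki.symm⟩
    obtain ⟨h, hh, _⟩ := tip_move hγ hr0 hr hl.symm m
    exact ((J.trans (hT _ _ _ _ hki.symm _ hf' _ hh)).trans
      (hT _ _ _ _ hkj _ hh _ hg')).trans J'.symm

theorem star_pc {γ : Fin 3 → ℝ → X} (hγ : IsStar γ) : PC (Star γ 1) :=
  fun ι _ f g hf hg => star_pc_aux hγ _ ι rfl 1 one_pos le_rfl f g hf hg

theorem star_infinite {γ : Fin 3 → ℝ → X} (hγ : IsStar γ) : (Star γ 1).Infinite := by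
  have h : (γ 0 '' Set.Icc 0 1).Infinite :=
    (Set.Icc_infinite (by norm_num : (0:ℝ) < 1)).image
      (fun s hs t ht h => (hγ.inj 0 0 s hs t ht h).1)
  refine h.mono ?_
  rintro _ ⟨s, hs, rfl⟩
  exact ⟨0, s, hs, rfl⟩

section graph

variable {V : Type} [Fintype V] [LinearOrder V] {G : SimpleGraph V} [DecidableRel G.Adj]

def vert (v : V) : (G.toFinGraph V).Realization := Quot.mk _ (Sum.inr v)

noncomputable def edge (e : (G.toFinGraph V).E) (t : ℝ) : (G.toFinGraph V).Realization :=
  Quot.mk _ (Sum.inl (e, Set.projIcc 0 1 zero_le_one t))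

noncomputable def pt {u w : V} (h : G.Adj u w) (t : ℝ) : (G.toFinGraph V).Realization :=
  if h' : u < w then edge (G := G) ⟨(u, w), h, h'⟩ t
  else edge (G := G) ⟨(w, u), h.symm, lt_of_le_of_ne (not_lt.1 h') h.ne'⟩ (1 - t)

theorem edge_cont (e : (G.toFinGraph V).E) : Continuous (edge (G := G) e) := by
  refine continuous_quot_mk.comp (continuous_inl.comp ?_)
  exact continuous_const.prodMk continuous_projIcc

theorem pt_cont {u w : V} (h : G.Adj u w) : Continuous (pt h) := by
  unfold pt
  split_ifs
  · exact edge_cont _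
  · exact (edge_cont _).comp (by fun_prop)

theorem edge_zero (e : (G.toFinGraph V).E) : edge (G := G) e 0 = vert (e.1.1) := by
  have : Set.projIcc (0:ℝ) 1 zero_le_one 0 = 0 := Set.projIcc_left _
  unfold edge
  rw [this]
  exact Quot.sound (FinGraph.GlueRel.src e)

theorem edge_one (e : (G.toFinGraph V).E) : edge (G := G) e 1 = vert (e.1.2) := by
  have : Set.projIcc (0:ℝ) 1 zero_le_one 1 = 1 := Set.projIcc_right _
  unfold edge
  rw [this]
  exact Quot.sound (FinGraph.GlueRel.tgt e)

theorem pt_zero {u w : V} (h : G.Adj u w) : pt h 0 = vert u := by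
  unfold pt
  split_ifs
  · exact edge_zero _
  · rw [sub_zero]; exact edge_one _

theorem pt_symm {u w : V} (h : G.Adj u w) (t : ℝ) : pt h.symm t = pt h (1 - t) := by
  unfold pt
  rcases lt_trichotomy u w with h' | h' | h'
  · rw [dif_pos h', dif_neg h'.not_gt]
  · exact absurd h' h.ne
  · rw [dif_pos h', dif_neg h'.not_gt, sub_sub_cancel]

theorem pt_one {u w : V} (h : G.Adj u w) : pt h 1 = vert w := by
  have := pt_symm h 0
  rw [sub_zero] at this
  rw [← this, pt_zero]

/-- barycentric coordinates -/
noncomputable def bary0 : (((G.toFinGraph V).E × unitInterval) ⊕ (G.toFinGraph V).V) → V → ℝ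
  | Sum.inl (e, t) => fun x => (1 - (t : ℝ)) * (if x = e.1.1 then 1 else 0) + t * (if x = e.1.2 then 1 else 0)
  | Sum.inr v => fun x => if x = (show V from v) then 1 else 0

noncomputable def bary : (G.toFinGraph V).Realization → V → ℝ :=
  Quot.lift (bary0 (G := G)) (by
    rintro _ _ (e | e)
    · funext x
      simp only [bary0]
      have : ((0 : unitInterval) : ℝ) = 0 := rfl
      rw [this]
      simp only [sub_zero, sub_self, one_mul, zero_mul, add_zero, zero_add]
      rfl
    · funext x
      simp only [bary0]
      have : ((1 : unitInterval) : ℝ) = 1 := rfl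
      rw [this]
      simp only [sub_zero, sub_self, one_mul, zero_mul, add_zero, zero_add]
      rfl)

theorem bary_edge (e : (G.toFinGraph V).E) {t : ℝ} (ht : t ∈ Set.Icc (0:ℝ) 1) (x : V) :
    bary (edge (G := G) e t) x = 
    (1 - (t : ℝ)) * (if x = e.1.1 then 1 else 0) + t * (if x = e.1.2 then 1 else 0) := by
  unfold edge
  rw [Set.projIcc_of_mem _ ht]
  rfl

theorem bary_pt {u w : V} (h : G.Adj u w) {t : ℝ} (ht : t ∈ Set.Icc (0:ℝ) 1) (x : V) :
    bary (pt h t) x = 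
    (1 - (t : ℝ)) * (if x = u then 1 else 0) + t * (if x = w then 1 else 0) := by
  unfold pt
  by_cases h' : u < w
  · rw [dif_pos h']
    exact bary_edge (G := G) _ ht x
  · rw [dif_neg h']
    have ht' : 1 - t ∈ Set.Icc (0:ℝ) 1 := ⟨by linarith [ht.2], by linarith [ht.1]⟩
    refine (bary_edge (G := G) _ ht' x).trans ?_
    simp only
    ring

theorem pt_inj {u w w' : V} (h : G.Adj u w) (h' : G.Adj u w') {s t : ℝ} (hs : s ∈ Set.Icc (0:ℝ) 1)
    (ht : t ∈ Set.Icc (0:ℝ) 1) (he : pt h s = pt h' t) : s = t ∧ (w = w' ∨ s = 0) := by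
  have h1 := congrFun (congrArg bary he) u
  have h2 := congrFun (congrArg bary he) w
  rw [bary_pt h hs, bary_pt h' ht] at h1 h2
  simp only [if_true, if_neg h.ne, if_neg h'.ne, if_neg h.ne'] at h1 h2
  refine ⟨by linarith, ?_⟩
  by_cases hw : w = w'
  · exact Or.inl hw
  · simp only [if_neg hw] at h2
    right; linarith

theorem pt_surj (hdeg : ∀ v, ∃ w, G.Adj v w) (x : (G.toFinGraph V).Realization) :
    ∃ (u w : V) (h : G.Adj u w), ∃ t ∈ Set.Icc (0:ℝ) 1, x = pt h t := by
  induction x using Quot.ind with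
  | mk a =>
  rcases a with ⟨e, t⟩ | v
  · refine ⟨e.1.1, e.1.2, e.2.1, t, t.2, ?_⟩
    unfold pt
    rw [dif_pos e.2.2]
    unfold edge
    rw [Set.projIcc_of_mem _ t.2]
    rfl
  · obtain ⟨w, hw⟩ := hdeg v
    exact ⟨v, w, hw, 0, ⟨le_rfl, zero_le_one⟩, (pt_zero hw).symm⟩

/-- union of the closed edges in `F` -/
def EU (F : Set (V × V)) : Set (G.toFinGraph V).Realization :=
  {x | ∃ (u w : V) (h : G.Adj u w), (u, w) ∈ F ∧ ∃ t ∈ Set.Icc (0:ℝ) 1, x = pt h t}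

theorem EU_insert (F : Set (V × V)) {u w : V} (h : G.Adj u w) :
    EU (G := G) (F ∪ {(u, w), (w, u)}) = EU F ∪ pt h '' Set.Icc 0 1 := by
  ext x
  constructor
  · rintro ⟨a, b, hab, hF | hF | hF, t, ht, rfl⟩
    · exact Or.inl ⟨a, b, hab, hF, t, ht, rfl⟩
    · obtain ⟨rfl, rfl⟩ := Prod.mk.inj hF
      exact Or.inr ⟨t, ht, rfl⟩
    · obtain ⟨rfl, rfl⟩ := Prod.mk.inj hF
      exact Or.inr ⟨1 - t, ⟨by linarith [ht.2], by linarith [ht.1]⟩, (pt_symm h t).symm⟩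
  · rintro (⟨a, b, hab, hF, t, ht, rfl⟩ | ⟨t, ht, rfl⟩)
    · exact ⟨a, b, hab, Or.inl hF, t, ht, rfl⟩
    · exact ⟨u, w, h, Or.inr (Or.inl rfl), t, ht, rfl⟩

theorem EU_mono {F F' : Set (V × V)} (h : F ⊆ F') : EU (G := G) F ⊆ EU F' := by
  rintro _ ⟨a, b, hab, hF, t, ht, rfl⟩
  exact ⟨a, b, hab, h hF, t, ht, rfl⟩

theorem EU_step (F : Set (V × V)) (hP : PC (EU (G := G) F)) (hinf : (EU (G := G) F).Infinite)
    {u w : V} (h : G.Adj u w) (hu : vert u ∈ EU (G := G) F) :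
    PC (EU (G := G) (F ∪ {(u, w), (w, u)})) := by
  rw [EU_insert F h]
  by_cases hd : ∀ t ∈ Set.Ioo (0:ℝ) 1, pt h t ∉ EU F
  · exact attach hP hinf (pt_cont h) (by rw [pt_zero]; exact hu)
      (fun s hs t ht he => (pt_inj h h hs ht he).1) hd
  · push Not at hd
    obtain ⟨t, ht, a, b, hab, hF, s, hs, he⟩ := hd
    have ht' : t ∈ Set.Icc (0:ℝ) 1 := ⟨ht.1.le, ht.2.le⟩
    have h1 := congrFun (congrArg bary he) u
    have h2 := congrFun (congrArg bary he) w
    rw [bary_pt h ht', bary_pt hab hs] at h1 h2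
    simp only [if_true, if_neg h.ne, if_neg h.ne'] at h1 h2
    have hsub : pt h '' Set.Icc 0 1 ⊆ EU (G := G) F := by
      rintro _ ⟨r, hr, rfl⟩
      have ht0 := ht.1
      have ht1 := ht.2
      have hne := h.ne
      by_cases hua : u = a
      · subst hua
        by_cases hwb : w = b
        · subst hwb
          exact ⟨u, w, h, hF, r, hr, rfl⟩
        · simp only [if_neg hwb, if_neg h.ne'] at h2
          linarith
      · by_cases hub : u = b
        · subst hub
          by_cases hwa : w = a
          · subst hwa
            refine ⟨w, u, hab, hF, 1 - r, ⟨by linarith [hr.2], by linarith [hr.1]⟩, ?_⟩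
            exact pt_symm hab r
          · simp only [if_neg hwa, if_neg h.ne'] at h2
            linarith
        · simp only [if_neg hua, if_neg hub] at h1
          linarith
    rwa [Set.union_eq_self_of_subset_right hsub]

theorem all_pc (hC : G.Connected) (hess : ∃ v, 3 ≤ G.degree v) :
    PC (Set.univ : Set (G.toFinGraph V).Realization) ∧
      (Set.univ : Set (G.toFinGraph V).Realization).Infinite := by
  obtain ⟨v, hv⟩ := hess
  obtain ⟨T, hT, hT3⟩ := Finset.exists_subset_card_eq hv
  let e : Fin 3 ≃ T := (T.equivFinOfCardEq hT3).symm
  have hadj : ∀ i, G.Adj v (e i) := fun i => by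
    have := hT (e i).2
    simpa using this
  have hst : IsStar (fun i => pt (hadj i)) := by
    refine ⟨fun i => pt_cont _, fun i j => by simp only [pt_zero], ?_⟩
    intro i j s hs t ht h
    obtain ⟨h1, h2⟩ := pt_inj _ _ hs ht h
    exact ⟨h1, h2.imp (fun h => e.injective (Subtype.ext h)) id⟩
  let F0 : Set (V × V) := Set.range fun i => (v, (e i : V))
  have hF0 : EU (G := G) F0 = Star (fun i => pt (hadj i)) 1 := by
    ext x
    constructor
    · rintro ⟨a, b, hab, ⟨i, hi⟩, t, ht, rfl⟩
      obtain ⟨rfl, rfl⟩ := Prod.mk.inj hi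
      exact ⟨i, t, ht, rfl⟩
    · rintro ⟨i, t, ht, rfl⟩
      exact ⟨v, e i, hadj i, ⟨i, rfl⟩, t, ht, rfl⟩
  obtain ⟨F, hF, hmax⟩ := Set.exists_max_image
    {F : Set (V × V) | F0 ⊆ F ∧ PC (EU (G := G) F)} Set.ncard (Set.toFinite _)
    ⟨F0, subset_rfl, hF0 ▸ star_pc hst⟩
  have hinf : (EU (G := G) F).Infinite := by
    refine Set.Infinite.mono (EU_mono hF.1) ?_
    rw [hF0]; exact star_infinite hst
  have step : ∀ u w, G.Adj u w → vert u ∈ EU (G := G) F → (u, w) ∈ F := by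
    intro u w h hu
    have h1 := hmax (F ∪ {(u, w), (w, u)})
      ⟨hF.1.trans Set.subset_union_left, EU_step F hF.2 hinf h hu⟩
    have h2 := Set.eq_of_subset_of_ncard_le (Set.subset_union_left) h1 (Set.toFinite _)
    rw [h2]
    exact Or.inr (Or.inl rfl)
  have hvert : ∀ u, vert u ∈ EU (G := G) F := by
    intro u
    obtain ⟨p⟩ := hC.preconnected u v
    induction p with
    | nil => exact ⟨_, _, hadj 0, hF.1 ⟨0, rfl⟩, 0, ⟨le_rfl, zero_le_one⟩, (pt_zero _).symm⟩
    | cons h p ih =>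
      have := step _ _ h.symm (ih hv hT hadj hst hF0 hF hmax)
      exact ⟨_, _, h.symm, this, 1, ⟨zero_le_one, le_rfl⟩, (pt_one _).symm⟩
  have huniv : EU (G := G) F = Set.univ := by
    refine Set.eq_univ_of_forall fun x => ?_
    have hdeg : ∀ u, ∃ w, G.Adj u w := by
      intro u
      by_cases h : u = v
      · exact ⟨_, h ▸ hadj 0⟩
      · have : Nontrivial V := ⟨u, v, h⟩
        exact hC.preconnected.exists_adj_of_nontrivial u
    obtain ⟨u, w, h, t, ht, rfl⟩ := pt_surj hdeg x
    exact ⟨u, w, h, step u w h (hvert u), t, ht, rfl⟩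
  rw [← huniv]
  exact ⟨hF.2, hinf⟩

end graph

end TreeConf

/-- Abrams' connectivity theorem for trees: if `Γ` is a finite tree with at least one essential
vertex (a vertex of degree `≥ 3`) and `n ≥ 2`, then the ordered configuration space `C^n(Γ)`
is path-connected; in particular any two points in a fiber of
`π : C^n(Γ) → UC^n(Γ)` are joined by a path. -/
theorem stmt_19 (V : Type) [Fintype V] [LinearOrder V] (G : SimpleGraph V)
    [DecidableRel G.Adj] (hT : G.IsTree) (hess : ∃ v, 3 ≤ G.degree v)
    (n : ℕ) (hn : 2 ≤ n) :
    PathConnectedSpace (OrderedConfig n (G.toFinGraph V).Realization) ∧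
    ∀ a a' : OrderedConfig n (G.toFinGraph V).Realization,
      (Quotient.mk (MulAction.orbitRel (Equiv.Perm (Fin n)) _) a :
          UnorderedConfig n (G.toFinGraph V).Realization) =
        Quotient.mk (MulAction.orbitRel (Equiv.Perm (Fin n)) _) a' →
      Joined a a' := by
  obtain ⟨hP, hinf⟩ := TreeConf.all_pc hT.connected hess
  have hJ : ∀ a b : OrderedConfig n (G.toFinGraph V).Realization, Joined a b := by
    intro a b
    have J := (hP (Fin n) a.1 b.1 ⟨a.2, fun _ => trivial⟩ ⟨b.2, fun _ => trivial⟩).joined_subtype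
    have hc : Continuous (fun f : TreeConf.Conf (Fin n)
        (Set.univ : Set (G.toFinGraph V).Realization) =>
        (⟨f.1, f.2.1⟩ : {f : Fin n → (G.toFinGraph V).Realization // Function.Injective f})) :=
      continuous_subtype_val.subtype_mk _
    exact J.map hc
  have hne : Nonempty (OrderedConfig n (G.toFinGraph V).Realization) := by
    have := hinf.to_subtype
    let emb := Infinite.natEmbedding (Set.univ : Set (G.toFinGraph V).Realization)
    exact ⟨⟨fun i => (emb i).1, fun i j h => Fin.ext (emb.injective (Subtype.ext h))⟩⟩
  exact ⟨⟨hne, hJ⟩, fun a a' _ => hJ a a'⟩
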